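/- arXiv:2409.03684 — 2 statements merged into one kernel-verified Lean document; each statement's English description precedes it below -/
import Mathlib

section
/- Let η ∈ (0,1) and let D be a probability distribution on ℝ supported on the interval [−(1−η), 1−η]. Let f : ℝⁿ → ℝ be a multilinear function satisfying |f(x)| ≤ 1 for all x ∈ [−1,1]ⁿ. Then for every natural number d there exists a multilinear function f^{≤d} : ℝⁿ → ℝ of total degree at most d such that E_{x ∼ D^{⊗n}}[(f(x) − f^{≤d}(x))²] ≤ (1−η)^{2d}. -/
open MeasureTheory

lemma shift_basis {n : ℕ} (c : Finset (Fin n) → ℝ) (m : ℝ) :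
    ∃ b : Finset (Fin n) → ℝ,
      (∀ d : ℕ, (∀ S, d < S.card → c S = 0) → ∀ S, d < S.card → b S = 0) ∧
      ∀ y : Fin n → ℝ, ∑ S : Finset (Fin n), c S * ∏ i ∈ S, (y i + m)
        = ∑ S : Finset (Fin n), b S * ∏ i ∈ S, y i := by
  classical
  refine ⟨fun T => ∑ S : Finset (Fin n), if T ⊆ S then c S * m ^ (S \ T).card else 0, ?_, ?_⟩
  · intro d hd T hT
    refine Finset.sum_eq_zero fun S _ => ?_
    split_ifs with h
    · rw [hd S (hT.trans_le (Finset.card_le_card h)), zero_mul]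
    · rfl
  · intro y
    simp_rw [Finset.sum_mul]
    rw [Finset.sum_comm]
    refine Finset.sum_congr rfl fun S _ => ?_
    rw [Finset.prod_add, Finset.mul_sum]
    have : S.powerset = Finset.univ.filter (fun T => T ⊆ S) := by ext; simp
    rw [this, Finset.sum_filter]
    refine Finset.sum_congr rfl fun T _ => ?_
    split_ifs with h
    · rw [Finset.prod_const]; ring
    · simp

lemma parseval_aux {n : ℕ} (ν : Measure ℝ) [IsProbabilityMeasure ν] (m v : ℝ)
    (h1 : Integrable (fun x => x - m) ν) (h2 : Integrable (fun x => (x - m) * (x - m)) ν)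
    (hm : ∫ x, (x - m) ∂ν = 0) (hv : ∫ x, (x - m) * (x - m) ∂ν = v)
    (b : Finset (Fin n) → ℝ) :
    ∫ x, (∑ S : Finset (Fin n), b S * ∏ i ∈ S, (x i - m)) ^ 2
      ∂(Measure.pi fun _ : Fin n => ν) = ∑ S : Finset (Fin n), b S ^ 2 * v ^ S.card := by
  classical
  let g : Finset (Fin n) → Finset (Fin n) → Fin n → ℝ → ℝ := fun S T i x =>
    (if i ∈ S then x - m else 1) * (if i ∈ T then x - m else 1)
  have hg : ∀ S T i, Integrable (g S T i) ν := by
    intro S T i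
    simp only [g]
    split_ifs <;> simp [h1, h2]
  have key : ∀ x : Fin n → ℝ, (∑ S : Finset (Fin n), b S * ∏ i ∈ S, (x i - m)) ^ 2
      = ∑ S : Finset (Fin n), ∑ T : Finset (Fin n), (b S * b T) * ∏ i, g S T i (x i) := by
    intro x
    rw [sq, Finset.sum_mul_sum]
    refine Finset.sum_congr rfl fun S _ => Finset.sum_congr rfl fun T _ => ?_
    simp only [g, Finset.prod_mul_distrib, Finset.prod_ite_mem, Finset.univ_inter]
    ring
  have hI : ∀ S T, Integrable (fun x : Fin n → ℝ => (b S * b T) * ∏ i, g S T i (x i))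
      (Measure.pi fun _ : Fin n => ν) := fun S T =>
    (Integrable.fintype_prod (f := g S T) (hg S T)).const_mul _
  simp_rw [key]
  rw [integral_finsetSum _ (fun S _ => integrable_finsetSum _ fun T _ => hI S T)]
  refine Finset.sum_congr rfl fun S _ => ?_
  rw [integral_finsetSum _ (fun T _ => hI S T), Finset.sum_eq_single S]
  · rw [integral_const_mul, integral_fintype_prod_eq_prod (fun i x => g S S i x)]
    have : ∀ i, ∫ x, g S S i x ∂ν = if i ∈ S then v else 1 := by
      intro i
      simp only [g]
      split_ifs
      · exact hv
      · simp
    simp_rw [this]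
    rw [Finset.prod_ite_mem, Finset.univ_inter, Finset.prod_const]; ring
  · intro T _ hT
    rw [integral_const_mul, integral_fintype_prod_eq_prod (fun i x => g S T i x)]
    have : ∃ i, ¬ (i ∈ S ↔ i ∈ T) := by
      by_contra! h
      exact hT (Finset.ext fun i => (h i).symm)
    obtain ⟨i, hi⟩ := this
    rw [Finset.prod_eq_zero (Finset.mem_univ i), mul_zero]
    simp only [g]
    by_cases hS : i ∈ S <;> by_cases hT : i ∈ T <;> simp_all
  · simp

lemma biased_measure (m : ℝ) (h1 : -1 ≤ m) (h2 : m ≤ 1) :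
    ∃ ν : Measure ℝ, IsProbabilityMeasure ν ∧ (∀ᵐ x ∂ν, x ∈ Set.Icc (-1 : ℝ) 1) ∧
      Integrable (fun x => x - m) ν ∧ Integrable (fun x => (x - m) * (x - m)) ν ∧
      ∫ x, (x - m) ∂ν = 0 ∧ ∫ x, (x - m) * (x - m) ∂ν = 1 - m ^ 2 := by
  have p1 : 0 ≤ (1 + m) / 2 := by linarith
  have p2 : 0 ≤ (1 - m) / 2 := by linarith
  have hi : ∀ (g : ℝ → ℝ) (a p : ℝ), Integrable g (ENNReal.ofReal p • Measure.dirac a) :=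
    fun g a p => (integrable_dirac (by simp)).smul_measure (by simp)
  refine ⟨ENNReal.ofReal ((1 + m) / 2) • Measure.dirac 1
    + ENNReal.ofReal ((1 - m) / 2) • Measure.dirac (-1), ⟨?_⟩, ?_, ?_, ?_, ?_, ?_⟩
  · simp only [Measure.coe_add, Measure.coe_smul, Pi.add_apply, Pi.smul_apply, measure_univ,
      smul_eq_mul, mul_one]
    rw [← ENNReal.ofReal_add p1 p2]
    ring_nf
    simp
  · rw [ae_add_measure_iff]
    constructor <;> refine Measure.ae_smul_measure ?_ _ <;> rw [ae_dirac_eq] <;> simp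
  · exact (hi _ _ _).add_measure (hi _ _ _)
  · exact (hi _ _ _).add_measure (hi _ _ _)
  · rw [integral_add_measure (hi _ _ _) (hi _ _ _), integral_smul_measure, integral_smul_measure,
      integral_dirac, integral_dirac, ENNReal.toReal_ofReal p1, ENNReal.toReal_ofReal p2]
    simp only [smul_eq_mul]; ring
  · rw [integral_add_measure (hi _ _ _) (hi _ _ _), integral_smul_measure, integral_smul_measure,
      integral_dirac, integral_dirac, ENNReal.toReal_ofReal p1, ENNReal.toReal_ofReal p2]
    simp only [smul_eq_mul]; ring

/-- Let `η ∈ (0,1)` and `D` a probability distribution on `ℝ` supported on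
`[-(1-η), 1-η]`.  Let `f : ℝⁿ → ℝ` be multilinear (given by coefficients `c` over
subsets of coordinates) with `|f x| ≤ 1` on `[-1,1]ⁿ`.  Then for every `d` there is a
multilinear `f^{≤d}` of total degree at most `d` with
`E_{x ∼ D^{⊗n}}[(f x - f^{≤d} x)²] ≤ (1-η)^{2d}`. -/
theorem low_degree_approximation_concentrated
    (n : ℕ) (η : ℝ) (hη : η ∈ Set.Ioo (0 : ℝ) 1)
    (D : Measure ℝ) [IsProbabilityMeasure D]
    (hsupp : ∀ᵐ x ∂D, x ∈ Set.Icc (-(1 - η)) (1 - η))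
    (f : (Fin n → ℝ) → ℝ) (c : Finset (Fin n) → ℝ)
    (hf : ∀ x, f x = ∑ S : Finset (Fin n), c S * ∏ i ∈ S, x i)
    (hbound : ∀ x : Fin n → ℝ, (∀ i, x i ∈ Set.Icc (-1 : ℝ) 1) → |f x| ≤ 1)
    (d : ℕ) :
    ∃ c' : Finset (Fin n) → ℝ,
      (∀ S : Finset (Fin n), d < S.card → c' S = 0) ∧
      ∫ x, (f x - ∑ S : Finset (Fin n), c' S * ∏ i ∈ S, x i) ^ 2
          ∂(Measure.pi fun _ : Fin n => D) ≤ (1 - η) ^ (2 * d) := by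
  classical
  obtain ⟨η0, η1⟩ := hη
  obtain ⟨ρ, hρ⟩ : ∃ ρ, ρ = 1 - η := ⟨_, rfl⟩
  rw [← hρ] at hsupp ⊢
  have r0 : 0 < ρ := by linarith
  have r1 : ρ < 1 := by linarith
  have ix : Integrable (fun x : ℝ => x) D := by
    refine Integrable.of_bound (C := ρ) (by fun_prop) ?_
    filter_upwards [hsupp] with x hx
    exact abs_le.2 hx
  have ixx : Integrable (fun x : ℝ => x * x) D := by
    refine Integrable.of_bound (C := ρ * ρ) (by fun_prop) ?_
    filter_upwards [hsupp] with x hx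
    rw [norm_mul]
    have := abs_le.2 hx
    exact mul_le_mul this this (abs_nonneg _) r0.le
  obtain ⟨m, hm⟩ : ∃ m, m = ∫ x, x ∂D := ⟨_, rfl⟩
  have habs : |m| ≤ ρ := by
    have := norm_integral_le_of_norm_le_const (μ := D) (f := fun x : ℝ => x) (C := ρ) (by
      filter_upwards [hsupp] with x hx
      exact abs_le.2 hx)
    rw [hm]; simpa using this
  have hxx : ∫ x, x * x ∂D ≤ ρ ^ 2 := by
    have : ∫ x, x * x ∂D ≤ ∫ x, ρ ^ 2 ∂D := by
      refine integral_mono_ae ixx (integrable_const _) ?_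
      filter_upwards [hsupp] with x hx
      have := hx.1
      have := hx.2
      nlinarith
    simpa using this
  have i1 : Integrable (fun x => x - m) D := ix.sub (integrable_const _)
  have e2 : (fun x => (x - m) * (x - m)) = fun x : ℝ => (x * x - (2 * m) * x) + m ^ 2 := by
    ext x; ring
  have i2 : Integrable (fun x => (x - m) * (x - m)) D := by
    rw [e2]
    exact (ixx.sub (ix.const_mul _)).add (integrable_const _)
  have z1 : ∫ x, (x - m) ∂D = 0 := by
    rw [integral_sub ix (integrable_const _), ← hm]; simp
  obtain ⟨v, hv⟩ : ∃ v, ∫ x, (x - m) * (x - m) ∂D = v := ⟨_, rfl⟩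
  have v0 : 0 ≤ v := hv ▸ integral_nonneg fun x => mul_self_nonneg _
  have m2 : m ^ 2 ≤ ρ ^ 2 := sq_le_sq' (abs_le.1 habs).1 (abs_le.1 habs).2
  have v1 : v ≤ ρ ^ 2 * (1 - m ^ 2) := by
    have i3 : Integrable (fun x : ℝ => x * x - (2 * m) * x) D := ixx.sub (ix.const_mul _)
    have : v = (∫ x, x * x ∂D) - m ^ 2 := by
      rw [← hv, e2, integral_add i3 (integrable_const _),
        integral_sub ixx (ix.const_mul _), integral_const_mul, ← hm]
      simp; ring
    have r2 : ρ ^ 2 ≤ 1 := pow_le_one₀ r0.le r1.le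
    nlinarith [mul_nonneg (sq_nonneg m) (sub_nonneg.2 r2)]
  obtain ⟨b, -, hb⟩ := shift_basis c m
  have hfb : ∀ x, f x = ∑ S : Finset (Fin n), b S * ∏ i ∈ S, (x i - m) := by
    intro x
    rw [hf, ← hb (fun i => x i - m)]
    simp
  obtain ⟨ν, hν, hνs, j1, j2, w1, w2⟩ := biased_measure m
    (by linarith [(abs_le.1 habs).1]) (by linarith [(abs_le.1 habs).2])
  have total : ∑ S : Finset (Fin n), b S ^ 2 * (1 - m ^ 2) ^ S.card ≤ 1 := by
    rw [← parseval_aux ν m _ j1 j2 w1 w2 b]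
    simp_rw [← hfb]
    have hae : ∀ᵐ x ∂(Measure.pi fun _ : Fin n => ν), ∀ i, x i ∈ Set.Icc (-1 : ℝ) 1 := by
      rw [ae_all_iff]
      intro i
      exact (Measure.tendsto_eval_ae_ae (μ := fun _ : Fin n => ν) (i := i)).eventually hνs
    have := norm_integral_le_of_norm_le_const (μ := Measure.pi fun _ : Fin n => ν)
      (f := fun x => f x ^ 2) (C := 1) (by
        filter_upwards [hae] with x hx
        rw [norm_pow]
        exact pow_le_one₀ (norm_nonneg _) (hbound x hx))
    refine (le_abs_self _).trans ?_
    simpa using this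
  obtain ⟨c', hc', hc'2⟩ := shift_basis (fun S => if d < S.card then 0 else b S) (-m)
  refine ⟨c', hc' d fun S hS => if_pos hS, ?_⟩
  have hdiff : ∀ x : Fin n → ℝ, f x - ∑ S : Finset (Fin n), c' S * ∏ i ∈ S, x i
      = ∑ S : Finset (Fin n), (if d < S.card then b S else 0) * ∏ i ∈ S, (x i - m) := by
    intro x
    rw [hfb, ← hc'2, ← Finset.sum_sub_distrib]
    refine Finset.sum_congr rfl fun S _ => ?_
    split_ifs <;> simp [sub_eq_add_neg]
  simp_rw [hdiff]
  rw [parseval_aux D m v i1 i2 z1 hv]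
  calc _ ≤ ∑ S : Finset (Fin n), ρ ^ (2 * d) * (b S ^ 2 * (1 - m ^ 2) ^ S.card) := by
        refine Finset.sum_le_sum fun S _ => ?_
        have q : 0 ≤ 1 - m ^ 2 := by nlinarith
        split_ifs with h
        · have a1 : v ^ S.card ≤ ρ ^ (2 * S.card) * (1 - m ^ 2) ^ S.card := by
            rw [pow_mul, ← mul_pow]
            exact pow_le_pow_left₀ v0 v1 _
          have a2 : ρ ^ (2 * S.card) ≤ ρ ^ (2 * d) :=
            pow_le_pow_of_le_one r0.le r1.le (by omega)
          calc b S ^ 2 * v ^ S.card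
              ≤ b S ^ 2 * (ρ ^ (2 * d) * (1 - m ^ 2) ^ S.card) := by
                refine mul_le_mul_of_nonneg_left (a1.trans ?_) (sq_nonneg _)
                exact mul_le_mul_of_nonneg_right a2 (pow_nonneg q _)
            _ = _ := by ring
        · have := pow_nonneg q S.card
          have := pow_nonneg r0.le (2 * d)
          simp only [ne_eq, OfNat.ofNat_ne_zero, not_false_eq_true, zero_pow, zero_mul]
          positivity
    _ = ρ ^ (2 * d) * ∑ S : Finset (Fin n), b S ^ 2 * (1 - m ^ 2) ^ S.card := by
        rw [Finset.mul_sum]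
    _ ≤ _ := mul_le_of_le_one_right (by positivity) total
end

section
/- Let η ∈ (0,1) and let D be a probability distribution over single-qubit density matrices such that E_{ρ∼D}[tr(Pρ)] = 0 for every P ∈ {X,Y,Z}, E_{ρ∼D}[tr(Pρ)tr(Qρ)] = 0 for all distinct P,Q ∈ {X,Y,Z}, and E_{ρ∼D}[tr(Pρ)²] ≤ 1−η for every P ∈ {X,Y,Z}. Let O be a 2ⁿ×2ⁿ Hermitian matrix with ‖O‖_op ≤ 1, with Pauli expansion O = Σ_{P ∈ {I,X,Y,Z}^{⊗n}} α_P · P where α_P = tr(OP)/2ⁿ, and for t ≥ 0 let O_low = Σ_{|P| < t} α_P · P, where |P| is the number of non-identity tensor components of P. Then E_{(ρ₁,…,ρ_n) ∼ D^{⊗n}}[tr((O − O_low)·(ρ₁⊗⋯⊗ρ_n))²] ≤ (1−η)^t. -/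
open MeasureTheory ComplexOrder

noncomputable section

instance : MeasurableSpace (Matrix (Fin 2) (Fin 2) ℂ) :=
  inferInstanceAs (MeasurableSpace (Fin 2 → Fin 2 → ℂ))

/-- The `ℓ₂ → ℓ₂` operator (spectral) norm of a square matrix. -/
def opNorm {𝕜 : Type*} [RCLike 𝕜] {m : Type*} [Fintype m] [DecidableEq m]
    (M : Matrix m m 𝕜) : ℝ :=
  ‖LinearMap.toContinuousLinearMap (Matrix.toEuclideanLin M)‖

/-- The Pauli matrices `X`, `Y`, `Z`. -/
def pauli : Fin 3 → Matrix (Fin 2) (Fin 2) ℂ :=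
  ![!![0, 1; 1, 0], !![0, -Complex.I; Complex.I, 0], !![1, 0; 0, -1]]

/-- The four single-qubit Paulis `I, X, Y, Z`. -/
def pauli4 : Fin 4 → Matrix (Fin 2) (Fin 2) ℂ :=
  ![1, pauli 0, pauli 1, pauli 2]

/-- The `n`-fold Kronecker product of single-qubit matrices, as a matrix indexed by
`Fin n → Fin 2`. -/
def tens {n : ℕ} (ρ : Fin n → Matrix (Fin 2) (Fin 2) ℂ) :
    Matrix (Fin n → Fin 2) (Fin n → Fin 2) ℂ :=
  Matrix.of fun a b => ∏ i, ρ i (a i) (b i)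

/-- The `n`-qubit Pauli observable indexed by a word `P : Fin n → Fin 4`. -/
def pauliTensor {n : ℕ} (P : Fin n → Fin 4) :
    Matrix (Fin n → Fin 2) (Fin n → Fin 2) ℂ :=
  tens fun i => pauli4 (P i)

/-- Real Bloch coordinates. -/
def bl (k : Fin 4) (ρ : Matrix (Fin 2) (Fin 2) ℂ) : ℝ := ((pauli4 k * ρ).trace).re

/-- weight of a Pauli word -/
def wt {n : ℕ} (P : Fin n → Fin 4) : ℕ := (Finset.univ.filter fun i => P i ≠ 0).card

lemma pauli4_complete (a b c d : Fin 2) :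
    ∑ k, pauli4 k a b * pauli4 k c d = if a = d ∧ b = c then 2 else 0 := by
  fin_cases a <;> fin_cases b <;> fin_cases c <;> fin_cases d <;>
    simp [Fin.sum_univ_four, pauli4, pauli] <;> norm_num

lemma pauli4_herm (k : Fin 4) : (pauli4 k).IsHermitian := by
  ext a b
  fin_cases k <;> fin_cases a <;> fin_cases b <;> simp [pauli4, pauli]

lemma pauliTensor_complete {n : ℕ} (a b c d : Fin n → Fin 2) :
    ∑ P : Fin n → Fin 4, pauliTensor P a b * pauliTensor P c d
      = if a = d ∧ b = c then 2 ^ n else 0 := by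
  have h : ∀ P : Fin n → Fin 4, pauliTensor P a b * pauliTensor P c d
      = ∏ i, (pauli4 (P i) (a i) (b i) * pauli4 (P i) (c i) (d i)) := by
    intro P
    simp [pauliTensor, tens, Finset.prod_mul_distrib]
  simp_rw [h]
  have h2 := Finset.prod_univ_sum (fun _ : Fin n => (Finset.univ : Finset (Fin 4)))
    (fun i k => pauli4 k (a i) (b i) * pauli4 k (c i) (d i))
  rw [Fintype.piFinset_univ] at h2
  rw [← h2]
  simp_rw [pauli4_complete]
  split_ifs with hh
  · obtain ⟨rfl, rfl⟩ := hh
    simp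
  · have : ∃ i, ¬ (a i = d i ∧ b i = c i) := by
      by_contra! hc
      exact hh ⟨funext fun i => (hc i).1, funext fun i => (hc i).2⟩
    obtain ⟨i, hi⟩ := this
    exact Finset.prod_eq_zero (Finset.mem_univ i) (if_neg hi)

lemma pauli_expand {n : ℕ} (O : Matrix (Fin n → Fin 2) (Fin n → Fin 2) ℂ) :
    ∑ P : Fin n → Fin 4, (((O * pauliTensor P).trace) / 2 ^ n) • pauliTensor P = O := by
  ext a b
  rw [Matrix.sum_apply]
  have h : ∀ P : Fin n → Fin 4,
      ((((O * pauliTensor P).trace) / 2 ^ n) • pauliTensor P) a b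
      = ∑ c, ∑ d, O c d / 2 ^ n * (pauliTensor P a b * pauliTensor P d c) := by
    intro P
    simp only [Matrix.smul_apply, smul_eq_mul, Matrix.trace, Matrix.diag, Matrix.mul_apply,
      Finset.sum_div, Finset.sum_mul]
    refine Finset.sum_congr rfl fun c _ => Finset.sum_congr rfl fun d _ => by ring
  simp_rw [h]
  rw [Finset.sum_comm]
  have h3 : ∀ c, ∑ P : Fin n → Fin 4,
      ∑ d, O c d / 2 ^ n * (pauliTensor P a b * pauliTensor P d c)
      = ∑ d, O c d / 2 ^ n * (if a = c ∧ b = d then 2 ^ n else 0) := by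
    intro c
    rw [Finset.sum_comm]
    refine Finset.sum_congr rfl fun d _ => ?_
    rw [← Finset.mul_sum, pauliTensor_complete]
  simp_rw [h3]
  rw [Finset.sum_eq_single a, Finset.sum_eq_single b]
  · simp
  · intro d _ hd
    simp [hd.symm]
  · simp
  · intro c _ hc
    simp [hc.symm]
  · simp

lemma pauliTensor_herm {n : ℕ} (P : Fin n → Fin 4) : (pauliTensor P).IsHermitian := by
  ext a b
  simp only [pauliTensor, tens, Matrix.conjTranspose_apply, Matrix.of_apply, star_prod]
  exact Finset.prod_congr rfl fun i _ => (pauli4_herm (P i)).apply _ _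

lemma trace_mul_real {m : Type*} [Fintype m] {A B : Matrix m m ℂ} (hA : A.IsHermitian)
    (hB : B.IsHermitian) : (((A * B).trace).re : ℂ) = (A * B).trace := by
  apply Complex.conj_eq_iff_re.1
  have : star (A * B).trace = (A * B).trace := by
    rw [← Matrix.trace_conjTranspose, Matrix.conjTranspose_mul, hA.eq, hB.eq, Matrix.trace_mul_comm]
  exact this

lemma trace_tens {n : ℕ} (P : Fin n → Fin 4) (ρ : Fin n → Matrix (Fin 2) (Fin 2) ℂ) :
    (pauliTensor P * tens ρ).trace = ∏ i, (pauli4 (P i) * ρ i).trace := by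
  simp only [Matrix.trace, Matrix.diag, Matrix.mul_apply, pauliTensor, tens, Matrix.of_apply]
  rw [Finset.prod_univ_sum, Fintype.piFinset_univ]
  refine Finset.sum_congr rfl fun a _ => ?_
  rw [Finset.prod_univ_sum, Fintype.piFinset_univ]
  refine Finset.sum_congr rfl fun b _ => ?_
  rw [Finset.prod_mul_distrib]

lemma trace_sq_le {m : Type*} [Fintype m] [DecidableEq m] {O : Matrix m m ℂ}
    (hO : O.IsHermitian) (hn : opNorm O ≤ 1) : ((O * O).trace).re ≤ Fintype.card m := by
  have h1 : ((O * O).trace).re = ∑ b, ∑ a, ‖O a b‖ ^ 2 := by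
    simp only [Matrix.trace, Matrix.diag, Matrix.mul_apply, Complex.re_sum]
    refine Finset.sum_congr rfl fun b _ => Finset.sum_congr rfl fun a _ => ?_
    rw [← hO.apply b a, ← Complex.normSq_eq_norm_sq, Complex.star_def,
      ← Complex.normSq_eq_conj_mul_self]
    simp
  rw [h1]
  have h2 : ∀ b, ∑ a, ‖O a b‖ ^ 2 ≤ 1 := by
    intro b
    have h := (LinearMap.toContinuousLinearMap (Matrix.toEuclideanLin O)).le_opNorm
      (EuclideanSpace.single b (1 : ℂ))
    have h3 : ‖(LinearMap.toContinuousLinearMap (Matrix.toEuclideanLin O))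
      (EuclideanSpace.single b (1 : ℂ))‖ ^ 2 = ∑ a, ‖O a b‖ ^ 2 := by
      rw [EuclideanSpace.norm_sq_eq]
      simp
    rw [← h3]
    have h4 : ‖(LinearMap.toContinuousLinearMap (Matrix.toEuclideanLin O))
      (EuclideanSpace.single b (1 : ℂ))‖ ≤ 1 := by
      refine h.trans ?_
      simpa [opNorm] using hn
    exact pow_le_one₀ (norm_nonneg _) h4
  calc _ ≤ ∑ b : m, (1 : ℝ) := Finset.sum_le_sum fun b _ => h2 b
    _ = _ := by simp

lemma parseval {n : ℕ} {O : Matrix (Fin n → Fin 2) (Fin n → Fin 2) ℂ}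
    (hO : O.IsHermitian) (hn : opNorm O ≤ 1) :
    ∑ P : Fin n → Fin 4, (((O * pauliTensor P).trace).re / 2 ^ n) ^ 2 ≤ 1 := by
  have h1 : (O * O).trace = ∑ P : Fin n → Fin 4,
      ((((O * pauliTensor P).trace).re / 2 ^ n) ^ 2 * 2 ^ n : ℝ) := by
    conv_lhs => rw [← pauli_expand O]
    rw [pauli_expand O, ← pauli_expand O, Matrix.mul_sum, Matrix.trace_sum, pauli_expand O]
    push_cast
    refine Finset.sum_congr rfl fun P _ => ?_
    rw [Matrix.mul_smul, Matrix.trace_smul, smul_eq_mul, trace_mul_real hO (pauliTensor_herm P)]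
    field_simp
  have h2 := trace_sq_le hO hn
  rw [h1, Complex.ofReal_re, ← Finset.sum_mul] at h2
  have h3 : ((Fintype.card (Fin n → Fin 2) : ℕ) : ℝ) = 2 ^ n := by simp
  rw [h3] at h2
  have : (0 : ℝ) < 2 ^ n := by positivity
  nlinarith

lemma bl_meas (k : Fin 4) : Measurable (bl k) := by
  have he : ∀ a b, Measurable fun ρ : Matrix (Fin 2) (Fin 2) ℂ => ρ a b := by
    intro a b
    exact (measurable_pi_apply b).comp (measurable_pi_apply (X := fun _ : Fin 2 => Fin 2 → ℂ) a)
  unfold bl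
  simp only [Matrix.trace, Matrix.diag, Matrix.mul_apply]
  apply Complex.measurable_re.comp
  exact Finset.measurable_sum _ fun a _ => Finset.measurable_sum _ fun b _ =>
    (he b a).const_mul _

lemma bl_bound (k : Fin 4) {ρ : Matrix (Fin 2) (Fin 2) ℂ} (h : ρ.PosSemidef)
    (ht : ρ.trace = 1) : |bl k ρ| ≤ 2 := by
  have h0 := h.diag_nonneg (i := 0)
  have h1 := h.diag_nonneg (i := 1)
  have hd := h.det_nonneg
  have hh := h.isHermitian.apply 0 1
  rw [Matrix.det_fin_two, ← hh] at hd
  rw [Matrix.trace_fin_two] at ht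
  have hr := congrArg Complex.re ht
  rw [Complex.le_def] at h0 h1 hd
  simp at h0 h1 hd hr
  have e1 : (ρ 0 1).re = (ρ 1 0).re := by rw [← hh]; simp
  have e2 : (ρ 0 1).im = -(ρ 1 0).im := by rw [← hh]; simp
  obtain ⟨h0, h0'⟩ := h0
  obtain ⟨h1, h1'⟩ := h1
  obtain ⟨hd, -⟩ := hd
  simp [← h0', ← h1'] at hd
  rw [abs_le]
  unfold bl
  rw [Matrix.trace_fin_two, Matrix.mul_apply, Matrix.mul_apply]
  simp only [Fin.sum_univ_two]
  fin_cases k <;> simp [pauli4, pauli, e1, e2] <;>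
    constructor <;> nlinarith [sq_nonneg (ρ 1 0).re, sq_nonneg (ρ 1 0).im]

lemma bl_moments (η : ℝ) (hη : η ∈ Set.Ioo (0 : ℝ) 1)
    (D : Measure (Matrix (Fin 2) (Fin 2) ℂ)) [IsProbabilityMeasure D]
    (hstate : ∀ᵐ ρ ∂D, ρ.PosSemidef ∧ ρ.trace = 1)
    (hmean : ∀ i : Fin 3, ∫ ρ, ((pauli i * ρ).trace).re ∂D = 0)
    (hcross : ∀ i j : Fin 3, i ≠ j →
      ∫ ρ, ((pauli i * ρ).trace).re * ((pauli j * ρ).trace).re ∂D = 0)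
    (hsecond : ∀ i : Fin 3, ∫ ρ, ((pauli i * ρ).trace).re ^ 2 ∂D ≤ 1 - η) :
    (∀ k l, k ≠ l → ∫ ρ, bl k ρ * bl l ρ ∂D = 0) ∧
    (∀ k, ∫ ρ, bl k ρ * bl k ρ ∂D ≤ if k ≠ 0 then 1 - η else 1) := by
  have hs : ∀ i : Fin 3, ∀ ρ, bl i.succ ρ = ((pauli i * ρ).trace).re := by
    intro i ρ
    fin_cases i <;> rfl
  have h0 : ∀ᵐ ρ ∂D, bl 0 ρ = 1 := by
    filter_upwards [hstate] with ρ h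
    simp [bl, pauli4, h.2]
  constructor
  · intro k l hkl
    induction k using Fin.cases with
    | zero =>
      induction l using Fin.cases with
      | zero => exact absurd rfl hkl
      | succ j =>
        rw [← hmean j]
        apply integral_congr_ae
        filter_upwards [h0] with ρ h
        rw [h, hs, one_mul]
    | succ i =>
      induction l using Fin.cases with
      | zero =>
        rw [← hmean i]
        apply integral_congr_ae
        filter_upwards [h0] with ρ h
        rw [h, hs, mul_one]
      | succ j =>
        simp_rw [hs]
        exact hcross i j fun h => hkl (by rw [h])
  · intro k
    induction k using Fin.cases with
    | zero =>
      apply le_of_eq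
      have : ∫ ρ, bl 0 ρ * bl 0 ρ ∂D = ∫ ρ, (1 : ℝ) ∂D := by
        apply integral_congr_ae
        filter_upwards [h0] with ρ h
        rw [h, one_mul]
      rw [this]
      simp
    | succ i =>
      rw [if_pos (Fin.succ_ne_zero i)]
      simp_rw [hs, ← pow_two]
      exact hsecond i

/-- low-degree truncation in the standard Pauli basis, mean-zero case.
Let `η ∈ (0,1)` and `D` a distribution over single-qubit density matrices with
`E[tr(Pρ)] = 0` for all `P ∈ {X,Y,Z}`, vanishing cross second moments, and
`E[tr(Pρ)²] ≤ 1-η`.  Let `O` be `2ⁿ×2ⁿ` Hermitian with `‖O‖_op ≤ 1`, with Pauli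
coefficients `α_P = tr(OP)/2ⁿ`, and let `O_low = ∑_{|P| < t} α_P P`.  Then
`E_{ρ ∼ D^{⊗n}}[tr((O - O_low) ρ₁⊗⋯⊗ρ_n)²] ≤ (1-η)^t`. -/
theorem pauli_truncation_mean_zero
    (n : ℕ) (η : ℝ) (hη : η ∈ Set.Ioo (0 : ℝ) 1)
    (D : Measure (Matrix (Fin 2) (Fin 2) ℂ)) [IsProbabilityMeasure D]
    (hstate : ∀ᵐ ρ ∂D, ρ.PosSemidef ∧ ρ.trace = 1)
    (hmean : ∀ i : Fin 3, ∫ ρ, ((pauli i * ρ).trace).re ∂D = 0)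
    (hcross : ∀ i j : Fin 3, i ≠ j →
      ∫ ρ, ((pauli i * ρ).trace).re * ((pauli j * ρ).trace).re ∂D = 0)
    (hsecond : ∀ i : Fin 3, ∫ ρ, ((pauli i * ρ).trace).re ^ 2 ∂D ≤ 1 - η)
    (O : Matrix (Fin n → Fin 2) (Fin n → Fin 2) ℂ)
    (hO : O.IsHermitian) (hOnorm : opNorm O ≤ 1) (t : ℕ) :
    ∫ ρ, (((O -
            ∑ P ∈ Finset.univ.filter
                (fun P : Fin n → Fin 4 => (Finset.univ.filter fun i => P i ≠ 0).card < t),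
              (((O * pauliTensor P).trace) / 2 ^ n) • pauliTensor P) *
          tens ρ).trace).re ^ 2
        ∂(Measure.pi fun _ : Fin n => D) ≤ (1 - η) ^ t := by
  set S := Finset.univ.filter (fun P : Fin n → Fin 4 => ¬ (wt P < t)) with hS
  set α : (Fin n → Fin 4) → ℝ := fun P => ((O * pauliTensor P).trace).re / 2 ^ n with hα
  obtain ⟨hm1, hm2⟩ := bl_moments η hη D hstate hmean hcross hsecond
  have hsub : O - ∑ P ∈ Finset.univ.filter
                (fun P : Fin n → Fin 4 => (Finset.univ.filter fun i => P i ≠ 0).card < t),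
              (((O * pauliTensor P).trace) / 2 ^ n) • pauliTensor P
      = ∑ P ∈ S, (α P : ℂ) • pauliTensor P := by
    have h := Finset.sum_filter_add_sum_filter_not (Finset.univ : Finset (Fin n → Fin 4))
      (fun P => wt P < t) (fun P => (((O * pauliTensor P).trace) / 2 ^ n) • pauliTensor P)
    rw [pauli_expand O] at h
    rw [sub_eq_iff_eq_add']
    refine h.symm.trans ?_
    congr 1
    refine Finset.sum_congr rfl fun P _ => ?_
    rw [hα]
    push_cast
    rw [trace_mul_real hO (pauliTensor_herm P)]
  rw [hsub]
  have hae : ∀ᵐ ρ ∂(Measure.pi fun _ : Fin n => D), ∀ i, (ρ i).PosSemidef ∧ (ρ i).trace = 1 := by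
    rw [ae_all_iff]
    intro i
    exact (Measure.tendsto_eval_ae_ae (μ := fun _ : Fin n => D) (i := i)).eventually hstate
  have hint : ∀ k l, Integrable (fun ρ => bl k ρ * bl l ρ) D := by
    intro k l
    refine Integrable.of_bound ((bl_meas k).mul (bl_meas l)).aestronglyMeasurable 4 ?_
    filter_upwards [hstate] with ρ h
    rw [Real.norm_eq_abs, abs_mul]
    have a := bl_bound k h.1 h.2
    have b := bl_bound l h.1 h.2
    nlinarith [abs_nonneg (bl k ρ), abs_nonneg (bl l ρ)]
  have heq : ∫ ρ, (((∑ P ∈ S, (α P : ℂ) • pauliTensor P) * tens ρ).trace).re ^ 2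
        ∂(Measure.pi fun _ : Fin n => D)
      = ∫ ρ, ∑ P ∈ S, ∑ Q ∈ S, α P * α Q * ∏ i, (bl (P i) (ρ i) * bl (Q i) (ρ i))
        ∂(Measure.pi fun _ : Fin n => D) := by
    apply integral_congr_ae
    filter_upwards [hae] with ρ h
    have h1 : (((∑ P ∈ S, (α P : ℂ) • pauliTensor P) * tens ρ).trace).re
        = ∑ P ∈ S, α P * ∏ i, bl (P i) (ρ i) := by
      rw [Matrix.sum_mul, Matrix.trace_sum, Complex.re_sum]
      refine Finset.sum_congr rfl fun P _ => ?_
      rw [Matrix.smul_mul, Matrix.trace_smul, trace_tens, smul_eq_mul, Complex.re_ofReal_mul]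
      congr 1
      have : ∏ i, (pauli4 (P i) * ρ i).trace = ((∏ i, bl (P i) (ρ i) : ℝ) : ℂ) := by
        push_cast
        exact Finset.prod_congr rfl fun i _ =>
          (trace_mul_real (pauli4_herm (P i)) (h i).1.isHermitian).symm
      rw [this, Complex.ofReal_re]
    rw [h1, pow_two, Finset.sum_mul_sum]
    refine Finset.sum_congr rfl fun P _ => Finset.sum_congr rfl fun Q _ => ?_
    rw [Finset.prod_mul_distrib]
    ring
  rw [heq]
  have hI : ∀ P Q : Fin n → Fin 4, Integrable
      (fun ρ : Fin n → Matrix (Fin 2) (Fin 2) ℂ =>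
        α P * α Q * ∏ i, (bl (P i) (ρ i) * bl (Q i) (ρ i))) (Measure.pi fun _ : Fin n => D) := by
    intro P Q
    exact (Integrable.fintype_prod (f := fun i ρ => bl (P i) ρ * bl (Q i) ρ)
      (fun i => hint (P i) (Q i))).const_mul _
  rw [integral_finsetSum _ fun P _ => integrable_finsetSum _ fun Q _ => hI P Q]
  have hval : ∀ P ∈ S, ∫ ρ, ∑ Q ∈ S, α P * α Q * ∏ i, (bl (P i) (ρ i) * bl (Q i) (ρ i))
        ∂(Measure.pi fun _ : Fin n => D) ≤ α P ^ 2 * (1 - η) ^ t := by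
    intro P hP
    rw [integral_finsetSum _ fun Q _ => hI P Q]
    have hQ : ∀ Q, ∫ ρ, α P * α Q * ∏ i, (bl (P i) (ρ i) * bl (Q i) (ρ i))
        ∂(Measure.pi fun _ : Fin n => D)
        = α P * α Q * ∏ i, ∫ ρ, bl (P i) ρ * bl (Q i) ρ ∂D := by
      intro Q
      rw [integral_const_mul]
      congr 1
      exact integral_fintype_prod_eq_prod (fun i ρ => bl (P i) ρ * bl (Q i) ρ)
    simp_rw [hQ]
    rw [Finset.sum_eq_single P]
    · rw [← pow_two]
      refine mul_le_mul_of_nonneg_left ?_ (sq_nonneg _)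
      calc ∏ i, ∫ ρ, bl (P i) ρ * bl (P i) ρ ∂D
          ≤ ∏ i, (if P i ≠ 0 then 1 - η else 1) :=
            Finset.prod_le_prod (fun i _ => integral_nonneg fun ρ => mul_self_nonneg _)
              fun i _ => hm2 (P i)
        _ = (1 - η) ^ wt P := by
            rw [Finset.prod_ite]
            simp [wt]
        _ ≤ (1 - η) ^ t := by
            refine pow_le_pow_of_le_one (by linarith [hη.2]) (by linarith [hη.1]) ?_
            simpa [hS] using hP
    · intro Q _ hne
      obtain ⟨i, hi⟩ := Function.ne_iff.1 hne
      rw [Finset.prod_eq_zero (Finset.mem_univ i) (hm1 _ _ hi.symm), mul_zero]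
    · exact fun h => absurd hP h
  refine (Finset.sum_le_sum hval).trans ?_
  rw [← Finset.sum_mul]
  have hle : ∑ P ∈ S, α P ^ 2 ≤ 1 :=
    (Finset.sum_le_univ_sum_of_nonneg fun P => sq_nonneg _).trans (parseval hO hOnorm)
  have hp : 0 ≤ (1 - η) ^ t := pow_nonneg (by linarith [hη.2]) _
  nlinarith

end
end
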